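/- Let 𝒳 and 𝒴 be boundedly compact pmm spaces. (i) For all r > 0, d(𝒳,𝒴) ≤ (1/r) ∨ 2·dc(B̄_r(𝒳), B̄_r(𝒴)). (ii) If 𝒳 and 𝒴 are compact, then d(𝒳,𝒴) ≤ 2·dc(𝒳,𝒴); consequently, on compact pmm spaces the topology induced by d is coarser than the topology of dc. -/

import Mathlib

open MeasureTheory Topology Filter

noncomputable section

/-- Prokhorov distance between finite Borel measures on a metric space. -/
def prokhorovDist {Z : Type*} [MetricSpace Z] [MeasurableSpace Z]
    (μ ν : Measure Z) : ℝ :=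
  sInf {ε : ℝ | 0 < ε ∧ ∀ A : Set Z, IsClosed A →
    μ A ≤ ν (Metric.cthickening ε A) + ENNReal.ofReal ε ∧
    ν A ≤ μ (Metric.cthickening ε A) + ENNReal.ofReal ε}

/-- A pointed measured metric space: a metric space with a distinguished point and a Borel
measure. -/
structure PMM : Type 1 where
  carrier : Type
  metric : MetricSpace carrier
  basepoint : carrier
  meas : @Measure carrier
    (@borel carrier metric.toPseudoMetricSpace.toUniformSpace.toTopologicalSpace)

attribute [instance] PMM.metric

instance PMM.instMeasurableSpace (𝒳 : PMM) : MeasurableSpace 𝒳.carrier := borel 𝒳.carrier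

instance PMM.instBorelSpace (𝒳 : PMM) : BorelSpace 𝒳.carrier := ⟨rfl⟩

/-- A pmm space is boundedly compact if every closed ball is compact and has finite measure. -/
def PMM.BoundedlyCompact (𝒳 : PMM) : Prop :=
  (∀ (x : 𝒳.carrier) (r : ℝ), IsCompact (Metric.closedBall x r)) ∧
  (∀ (x : 𝒳.carrier) (r : ℝ), 𝒳.meas (Metric.closedBall x r) ≠ ⊤)

/-- A pmm space is compact if its carrier is compact and its measure is finite. -/
def PMM.IsCompactPMM (𝒳 : PMM) : Prop :=
  CompactSpace 𝒳.carrier ∧ 𝒳.meas Set.univ ≠ ⊤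

/-- A pair of maps of two pmm spaces into a common metric space. -/
structure GHPEmbedding (𝒳 𝒴 : PMM) : Type 1 where
  Z : Type
  mZ : MetricSpace Z
  f : 𝒳.carrier → Z
  g : 𝒴.carrier → Z

attribute [instance] GHPEmbedding.mZ

/-- Both maps of a `GHPEmbedding` are isometric embeddings. -/
def GHPEmbedding.IsIsometric {𝒳 𝒴 : PMM} (e : GHPEmbedding 𝒳 𝒴) : Prop :=
  Isometry e.f ∧ Isometry e.g

/-- The quantity `max(d(f o_X, g o_Y), dH(f(X), g(Y)), dP(f_*μ_X, g_*μ_Y))` associated to a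
pair of embeddings into a common space. -/
def GHPEmbedding.value {𝒳 𝒴 : PMM} (e : GHPEmbedding 𝒳 𝒴) : ℝ :=
  letI : MeasurableSpace e.Z := borel e.Z
  max (dist (e.f 𝒳.basepoint) (e.g 𝒴.basepoint))
    (max (Metric.hausdorffDist (Set.range e.f) (Set.range e.g))
      (prokhorovDist (𝒳.meas.map e.f) (𝒴.meas.map e.g)))

/-- The Gromov-Hausdorff-Prokhorov distance of compact pmm spaces. -/
def cGHP (𝒳 𝒴 : PMM) : ℝ :=
  sInf {x : ℝ | ∃ e : GHPEmbedding 𝒳 𝒴, e.IsIsometric ∧ x = e.value}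

/-- A pmm-subspace of a pmm space `𝒳`: a subset containing the basepoint together with a
measure `≤ 𝒳.meas` supported on the subset. -/
structure SubPMM (𝒳 : PMM) where
  set : Set 𝒳.carrier
  root_mem : 𝒳.basepoint ∈ set
  meas : Measure 𝒳.carrier
  meas_le : meas ≤ 𝒳.meas
  supported : meas setᶜ = 0

/-- The pmm space associated to a pmm-subspace. -/
def SubPMM.toPMM {𝒳 : PMM} (S : SubPMM 𝒳) : PMM where
  carrier := ↥S.set
  metric := inferInstance
  basepoint := ⟨𝒳.basepoint, S.root_mem⟩
  meas := @Measure.comap ↥S.set 𝒳.carrier (borel ↥S.set) inferInstance Subtype.val S.meas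

/-- The pmm-subspace ordering: inclusion of sets and inequality of measures. -/
instance {𝒳 : PMM} : LE (SubPMM 𝒳) :=
  ⟨fun S T => S.set ⊆ T.set ∧ S.meas ≤ T.meas⟩

/-- Compactness of a pmm-subspace. -/
def SubPMM.IsCompactSub {𝒳 : PMM} (S : SubPMM 𝒳) : Prop :=
  IsCompact S.set ∧ S.meas Set.univ ≠ ⊤

/-- The closed ball of radius `r` around the basepoint, as a pmm-subspace (for `r ≥ 0` the
underlying set is exactly the closed ball; the basepoint is inserted so that the definition
makes sense for all `r`). -/
def PMM.ballSub (𝒳 : PMM) (r : ℝ) : SubPMM 𝒳 where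
  set := insert 𝒳.basepoint (Metric.closedBall 𝒳.basepoint r)
  root_mem := Set.mem_insert _ _
  meas := 𝒳.meas.restrict (insert 𝒳.basepoint (Metric.closedBall 𝒳.basepoint r))
  meas_le := Measure.restrict_le_self
  supported := by
    rw [Measure.restrict_apply ((measurableSet_closedBall.insert 𝒳.basepoint).compl),
      Set.compl_inter_self]
    simp

/-- The quantity `a(ε, r; 𝒳, 𝒴)`. -/
def aFun (ε r : ℝ) (𝒳 𝒴 : PMM) : ℝ :=
  sInf {x : ℝ | ∃ Y' : SubPMM 𝒴, Y'.IsCompactSub ∧ 𝒴.ballSub (r - ε) ≤ Y' ∧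
    x = cGHP ((𝒳.ballSub r).toPMM) Y'.toPMM}

/-- The quantity `a_ε(𝒳, 𝒴) = a(ε, 1/ε; 𝒳, 𝒴)`. -/
def aEps (ε : ℝ) (𝒳 𝒴 : PMM) : ℝ := aFun ε (1 / ε) 𝒳 𝒴

/-- The Gromov-Hausdorff-Prokhorov distance of boundedly compact pmm spaces
(with `inf ∅ = 1`). -/
def GHP (𝒳 𝒴 : PMM) : ℝ :=
  sInf (insert 1 {ε : ℝ | ε ∈ Set.Ioc (0 : ℝ) 1 ∧ max (aEps ε 𝒳 𝒴) (aEps ε 𝒴 𝒳) < ε / 2})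

/-- Two pmm spaces are GHP-isometric if there is a root-preserving measure-preserving
surjective isometry between them. -/
def GHPIsometric (𝒳 𝒴 : PMM) : Prop :=
  ∃ ρ : 𝒳.carrier → 𝒴.carrier, Isometry ρ ∧ Function.Surjective ρ ∧
    ρ 𝒳.basepoint = 𝒴.basepoint ∧ 𝒳.meas.map ρ = 𝒴.meas

/-- `r` is a continuity radius of a pmm space. -/
def PMM.ContinuityRadius (𝒳 : PMM) (r : ℝ) : Prop :=
  0 < r ∧ Metric.closedBall 𝒳.basepoint r = closure (Metric.ball 𝒳.basepoint r) ∧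
    𝒳.meas (Metric.closedBall 𝒳.basepoint r \ Metric.ball 𝒳.basepoint r) = 0

/-- Approximate finite max-flow min-cut via Hall's theorem. -/
lemma flow_one {ι : Type} [Fintype ι] [DecidableEq ι] (p q : ι → ℝ) (hp : ∀ i, 0 ≤ p i)
    (hq : ∀ i, 0 ≤ q i) (R : ι → ι → Prop) [DecidableRel R] (d η : ℝ) (hη : 0 < η)
    (h : ∀ S : Finset ι, ∑ i ∈ S, p i ≤
      ∑ j ∈ Finset.univ.filter (fun j => ∃ i ∈ S, R i j), q j + d) :
    ∃ α : ι → ι → ℝ, (∀ i j, 0 ≤ α i j) ∧ (∀ i j, α i j ≠ 0 → R i j) ∧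
      (∀ i, ∑ j, α i j ≤ p i) ∧ (∀ j, ∑ i, α i j ≤ q j) ∧
      ∑ i, p i ≤ ∑ i, ∑ j, α i j + d + η := by
  classical
  have hd : 0 ≤ d := by simpa using h ∅
  set n : ℕ := Fintype.card ι with hn
  obtain ⟨N, hN⟩ := exists_nat_gt ((2 * n + 1) / η)
  have hN0 : (0 : ℝ) < N := lt_of_le_of_lt (by positivity) hN
  have hNη : (2 * n + 1 : ℝ) ≤ N * η := by
    rw [div_lt_iff₀ hη] at hN; exact hN.le
  let m : ι → ℕ := fun i => ⌊N * p i⌋₊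
  let k : ι → ℕ := fun i => ⌊N * q i⌋₊
  have hm1 : ∀ i, (m i : ℝ) ≤ N * p i := fun i =>
    Nat.floor_le (mul_nonneg hN0.le (hp i))
  have hm2 : ∀ i, (N * p i : ℝ) ≤ m i + 1 := fun i => (Nat.lt_floor_add_one _).le
  have hk1 : ∀ i, (k i : ℝ) ≤ N * q i := fun i =>
    Nat.floor_le (mul_nonneg hN0.le (hq i))
  have hk2 : ∀ i, (N * q i : ℝ) ≤ k i + 1 := fun i => (Nat.lt_floor_add_one _).le
  let D : ℕ := ⌈N * d⌉₊ + n
  have hD1 : (N * d : ℝ) + n ≤ D := by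
    have := Nat.le_ceil (N * d : ℝ)
    simp only [D]; push_cast; linarith
  have hD2 : (D : ℝ) ≤ N * d + 1 + n := by
    have := Nat.ceil_lt_add_one (mul_nonneg hN0.le hd)
    simp only [D]; push_cast; linarith
  let t : (Σ i, Fin (m i)) → Finset ((Σ j, Fin (k j)) ⊕ Fin D) := fun x =>
    Finset.univ.filter (fun y => Sum.elim (fun z => R x.1 z.1) (fun _ => True) y)
  have hall : ∀ s : Finset (Σ i, Fin (m i)), s.card ≤ (s.biUnion t).card := by
    intro s
    rcases s.eq_empty_or_nonempty with rfl | ⟨x0, hx0⟩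
    · simp
    set S := s.image Sigma.fst with hS
    have h1 : s.card ≤ ∑ i ∈ S, m i := by
      have : s ⊆ S.sigma (fun i => (Finset.univ : Finset (Fin (m i)))) := by
        intro x hx
        simp only [Finset.mem_sigma, Finset.mem_univ, and_true, hS]
        exact Finset.mem_image_of_mem _ hx
      calc s.card ≤ _ := Finset.card_le_card this
        _ = _ := by simp [Finset.card_sigma]
    set T := Finset.univ.filter (fun j => ∃ i ∈ S, R i j) with hT
    have h2 : ∑ j ∈ T, k j + D ≤ (s.biUnion t).card := by
      have : (T.sigma (fun j => (Finset.univ : Finset (Fin (k j))))).disjSum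
          (Finset.univ : Finset (Fin D)) ⊆ s.biUnion t := by
        intro y hy
        rw [Finset.mem_biUnion]
        rcases y with y | y
        · simp only [Finset.inl_mem_disjSum, Finset.mem_sigma, Finset.mem_univ, and_true, hT,
            Finset.mem_filter, true_and, hS, Finset.mem_image] at hy
          obtain ⟨i, ⟨x, hx, rfl⟩, hR⟩ := hy
          exact ⟨x, hx, by simpa [t] using hR⟩
        · exact ⟨x0, hx0, by simp [t]⟩
      calc _ = _ := by simp [Finset.card_sigma]
        _ ≤ _ := Finset.card_le_card this
    refine h1.trans (le_trans ?_ h2)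
    have h3 : (∑ i ∈ S, (m i : ℝ)) ≤ N * ∑ i ∈ S, p i := by
      rw [Finset.mul_sum]; exact Finset.sum_le_sum fun i _ => hm1 i
    have h4 : N * ∑ j ∈ T, q j ≤ (∑ j ∈ T, (k j : ℝ)) + n := by
      rw [Finset.mul_sum]
      calc _ ≤ ∑ j ∈ T, ((k j : ℝ) + 1) := Finset.sum_le_sum fun i _ => hk2 i
        _ = (∑ j ∈ T, (k j : ℝ)) + T.card := by simp [Finset.sum_add_distrib]
        _ ≤ _ := by
          have : (T.card : ℝ) ≤ n := by exact_mod_cast Finset.card_le_univ T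
          linarith
    have h5 := mul_le_mul_of_nonneg_left (h S) hN0.le
    rw [mul_add] at h5
    have : (∑ i ∈ S, (m i : ℝ)) ≤ (∑ j ∈ T, (k j : ℝ)) + D := by linarith
    exact_mod_cast this
  obtain ⟨φ, hφ, hφt⟩ := (Finset.all_card_le_biUnion_card_iff_exists_injective t).mp hall
  let β : (Σ i, Fin (m i)) → Option ι := fun x =>
    Sum.elim (fun z => some z.1) (fun _ => none) (φ x)
  have hβR : ∀ x j, β x = some j → R x.1 j := by
    intro x j hx
    have := hφt x
    simp only [t, Finset.mem_filter, Finset.mem_univ, true_and] at this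
    simp only [β] at hx
    rcases hy : φ x with y | y
    · rw [hy] at this hx
      simp at this hx
      rw [← hx]; exact this
    · rw [hy] at hx; simp at hx
  let c : ι → ι → ℕ := fun i j => (Finset.univ.filter (fun x : Σ i, Fin (m i) =>
    x.1 = i ∧ β x = some j)).card
  have hrow : ∀ i, ∑ j, c i j ≤ m i := by
    intro i
    have e : ∑ j, c i j ≤ (Finset.univ.filter (fun x : Σ i, Fin (m i) => x.1 = i)).card := by
      rw [← Finset.card_biUnion]
      · apply Finset.card_le_card
        intro x hx
        simp only [Finset.mem_biUnion, Finset.mem_filter, Finset.mem_univ, true_and] at hx ⊢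
        exact hx.choose_spec.1
      · intro a _ b _ hab
        refine Finset.disjoint_left.mpr ?_
        intro x hx hx'
        simp only [Finset.mem_filter, Finset.mem_univ, true_and] at hx hx'
        exact hab (Option.some.inj (hx.2.symm.trans hx'.2))
    refine e.trans ?_
    have : Finset.univ.filter (fun x : Σ i, Fin (m i) => x.1 = i) ⊆
        (Finset.univ : Finset (Fin (m i))).image (fun y => (⟨i, y⟩ : Σ i, Fin (m i))) := by
      rintro ⟨a, y⟩ hx
      simp only [Finset.mem_filter, Finset.mem_univ, true_and] at hx
      subst hx
      simp
    calc _ ≤ _ := Finset.card_le_card this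
      _ ≤ _ := Finset.card_image_le
      _ = m i := by simp
  have hcol0 : ∀ j, ∑ i, c i j = (Finset.univ.filter (fun x => β x = some j)).card := by
    intro j
    rw [← Finset.card_biUnion]
    · congr 1
      ext x
      simp
    · intro a _ b _ hab
      refine Finset.disjoint_left.mpr ?_
      intro x hx hx'
      simp only [Finset.mem_filter, Finset.mem_univ, true_and] at hx hx'
      exact hab (hx.1.symm.trans hx'.1)
  have hcol : ∀ j, ∑ i, c i j ≤ k j := by
    intro j
    rw [hcol0, ← Finset.card_image_of_injective _ hφ]
    have : (Finset.univ.filter (fun x => β x = some j)).image φ ⊆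
        (Finset.univ : Finset (Fin (k j))).image
          (fun y => (Sum.inl ⟨j, y⟩ : (Σ j, Fin (k j)) ⊕ Fin D)) := by
      intro z hz
      simp only [Finset.mem_image, Finset.mem_filter, Finset.mem_univ, true_and, β] at hz ⊢
      obtain ⟨x, hx, rfl⟩ := hz
      rcases hy : φ x with ⟨a, y⟩ | y
      · rw [hy] at hx
        simp at hx
        subst hx
        exact ⟨y, rfl⟩
      · rw [hy] at hx; simp at hx
    calc _ ≤ _ := Finset.card_le_card this
      _ ≤ _ := Finset.card_image_le
      _ = k j := by simp
  have htot : ∑ i, m i ≤ ∑ i, ∑ j, c i j + D := by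
    rw [Finset.sum_comm]
    simp_rw [hcol0]
    have hnone : (Finset.univ.filter (fun x => β x = none)).card ≤ D := by
      rw [← Finset.card_image_of_injective _ hφ]
      have : (Finset.univ.filter (fun x => β x = none)).image φ ⊆
          (Finset.univ : Finset (Fin D)).image
            (fun y => (Sum.inr y : (Σ j, Fin (k j)) ⊕ Fin D)) := by
        intro z hz
        simp only [Finset.mem_image, Finset.mem_filter, Finset.mem_univ, true_and, β] at hz ⊢
        obtain ⟨x, hx, rfl⟩ := hz
        rcases hy : φ x with ⟨a, y⟩ | y
        · rw [hy] at hx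
          simp at hx
        · exact ⟨y, rfl⟩
      calc _ ≤ _ := Finset.card_le_card this
        _ ≤ _ := Finset.card_image_le
        _ = D := by simp
    have e1 : ∑ i, m i = (Finset.univ : Finset (Σ i, Fin (m i))).card := by
      simp [Finset.card_univ]
    have e2 := Finset.card_eq_sum_card_fiberwise (f := β)
      (s := (Finset.univ : Finset (Σ i, Fin (m i)))) (t := Finset.univ) (by simp)
    rw [Fintype.sum_option] at e2
    rw [e1, e2]
    omega
  refine ⟨fun i j => (c i j : ℝ) / N, fun i j => by positivity, ?_, ?_, ?_, ?_⟩
  · intro i j hij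
    have : c i j ≠ 0 := by
      intro h0; simp [h0] at hij
    obtain ⟨x, hx⟩ := Finset.card_pos.mp (Nat.pos_of_ne_zero this)
    simp only [Finset.mem_filter, Finset.mem_univ, true_and] at hx
    have := hβR x j hx.2
    rwa [hx.1] at this
  · intro i
    rw [← Finset.sum_div, div_le_iff₀ hN0]
    have : (∑ j, (c i j : ℝ)) ≤ m i := by exact_mod_cast hrow i
    linarith [hm1 i]
  · intro j
    rw [← Finset.sum_div, div_le_iff₀ hN0]
    have : (∑ i, (c i j : ℝ)) ≤ k j := by exact_mod_cast hcol j
    linarith [hk1 j]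
  · simp_rw [← Finset.sum_div]
    have h1 : (∑ i, (m i : ℝ)) ≤ ∑ i, ∑ j, (c i j : ℝ) + D := by exact_mod_cast htot
    have h2 : N * ∑ i, p i ≤ ∑ i, (m i : ℝ) + n := by
      rw [Finset.mul_sum]
      calc _ ≤ ∑ i, ((m i : ℝ) + 1) := Finset.sum_le_sum fun i _ => hm2 i
        _ = _ := by simp [Finset.sum_add_distrib, hn]
    set C := ∑ i, ∑ j, (c i j : ℝ)
    have h3 : N * (C / N) = C := by field_simp
    refine le_of_mul_le_mul_left ?_ hN0
    rw [mul_add, mul_add, h3]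
    linarith

/-- Two-sided approximate flow with uniform defects. -/
lemma flow_two {ι : Type} [Fintype ι] [DecidableEq ι] (p q : ι → ℝ) (hp : ∀ i, 0 ≤ p i)
    (hq : ∀ i, 0 ≤ q i) (R : ι → ι → Prop) [DecidableRel R] (δ η : ℝ) (hη : 0 < η)
    (h1 : ∀ S : Finset ι, ∑ i ∈ S, p i ≤
      ∑ j ∈ Finset.univ.filter (fun j => ∃ i ∈ S, R i j), q j + δ)
    (h2 : ∀ S : Finset ι, ∑ j ∈ S, q j ≤
      ∑ i ∈ Finset.univ.filter (fun i => ∃ j ∈ S, R i j), p i + δ) :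
    ∃ α : ι → ι → ℝ, (∀ i j, 0 ≤ α i j) ∧ (∀ i j, α i j ≠ 0 → R i j) ∧
      (∀ i, ∑ j, α i j ≤ p i) ∧ (∀ j, ∑ i, α i j ≤ q j) ∧
      (∀ S : Finset ι, ∑ i ∈ S, p i ≤ ∑ i ∈ S, ∑ j, α i j + (δ + η)) ∧
      (∀ S : Finset ι, ∑ j ∈ S, q j ≤ ∑ j ∈ S, ∑ i, α i j + (δ + η)) := by
  obtain ⟨α, ha, hR, hrow, hcol, htot⟩ := flow_one p q hp hq R
    (min δ (∑ i, p i - ∑ j, q j + δ)) η hη (by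
      intro S
      rw [← min_add_add_left, le_min_iff]
      refine ⟨h1 S, ?_⟩
      have e : ∑ j ∈ Finset.univ.filter (fun j => ∃ i ∈ S, R i j), q j +
          ∑ j ∈ Finset.univ.filter (fun j => ¬ ∃ i ∈ S, R i j), q j = ∑ j, q j := by
        convert Finset.sum_filter_add_sum_filter_not Finset.univ (fun j => ∃ i ∈ S, R i j) q
      have e' := Finset.sum_compl_add_sum S p
      have hle : ∑ j ∈ Finset.univ.filter (fun j => ¬ ∃ i ∈ S, R i j), q j ≤
          ∑ i ∈ Sᶜ, p i + δ := by
        refine (h2 _).trans (add_le_add ?_ le_rfl)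
        apply Finset.sum_le_sum_of_subset_of_nonneg
        · intro i hi
          simp only [Finset.mem_filter, Finset.mem_univ, true_and, Finset.mem_compl] at hi ⊢
          obtain ⟨j, hj, hij⟩ := hi
          exact fun hiS => hj ⟨i, hiS, hij⟩
        · intros; apply hp
      linarith)
  refine ⟨α, ha, hR, hrow, hcol, ?_, ?_⟩
  · intro S
    have e := Finset.sum_compl_add_sum S p
    have e' := Finset.sum_compl_add_sum S (fun i => ∑ j, α i j)
    have : ∑ i ∈ Sᶜ, ∑ j, α i j ≤ ∑ i ∈ Sᶜ, p i := Finset.sum_le_sum fun i _ => hrow i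
    have := min_le_left δ (∑ i, p i - ∑ j, q j + δ)
    linarith
  · intro S
    rw [Finset.sum_comm] at htot
    have e := Finset.sum_compl_add_sum S q
    have e' := Finset.sum_compl_add_sum S (fun j => ∑ i, α i j)
    have : ∑ j ∈ Sᶜ, ∑ i, α i j ≤ ∑ j ∈ Sᶜ, q j := Finset.sum_le_sum fun i _ => hcol i
    have := min_le_right δ (∑ i, p i - ∑ j, q j + δ)
    linarith

/-- The Prokhorov comparison of two measures at scale `ε`. -/
def ProkLE {Z : Type} [MetricSpace Z] [MeasurableSpace Z] (μ ν : Measure Z) (ε : ℝ) : Prop :=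
  ∀ A : Set Z, IsClosed A →
    μ A ≤ ν (Metric.cthickening ε A) + ENNReal.ofReal ε ∧
    ν A ≤ μ (Metric.cthickening ε A) + ENNReal.ofReal ε

lemma exists_label {Z : Type} [MetricSpace Z] [MeasurableSpace Z] [BorelSpace Z]
    (C K L : Set Z) (hC : IsCompact C) (hK : MeasurableSet K) (hL : MeasurableSet L)
    (η : ℝ) (hη : 0 < η) :
    ∃ (ι : Type) (_ : Fintype ι) (_ : DecidableEq ι) (c : Z → ι),
      (∀ i, MeasurableSet (c ⁻¹' {i})) ∧
      (∀ x ∈ C, ∀ y ∈ C, c x = c y → dist x y ≤ η) ∧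
      (∀ x y, c x = c y → x ∈ K → y ∈ K) ∧ (∀ x y, c x = c y → x ∈ L → y ∈ L) := by
  classical
  obtain ⟨t, -, htf, ht⟩ := hC.finite_cover_balls (half_pos hη)
  have : Fintype t := htf.fintype
  have hdec : ∀ s : Set Z, MeasurableSet s → Measurable (fun x => decide (x ∈ s)) := by
    intro s hs
    apply measurable_to_bool
    convert hs using 1
    ext x; simp
  let c : Z → (t → Bool) × Bool × Bool := fun x =>
    (fun y => decide (x ∈ Metric.ball (y : Z) (η / 2)), decide (x ∈ K), decide (x ∈ L))
  have hc : Measurable c :=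
    (measurable_pi_lambda _ fun y => hdec _ measurableSet_ball).prodMk
      ((hdec _ hK).prodMk (hdec _ hL))
  refine ⟨_, inferInstance, inferInstance, c, fun i => hc (measurableSet_singleton i), ?_, ?_, ?_⟩
  · intro x hx y _ hxy
    have hx' := ht hx
    simp only [Set.mem_iUnion] at hx'
    obtain ⟨z, hz, hxz⟩ := hx'
    have h1 := congrFun (congrArg Prod.fst hxy) ⟨z, hz⟩
    have hyz : y ∈ Metric.ball z (η / 2) := by
      simp only [c, decide_eq_decide] at h1
      exact h1.mp hxz
    rw [Metric.mem_ball] at hxz hyz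
    have := dist_triangle_right x y z
    linarith
  · intro x y hxy hx
    have h1 := congrArg (fun u => u.2.1) hxy
    simp only [c, decide_eq_decide] at h1
    exact h1.mp hx
  · intro x y hxy hx
    have h1 := congrArg (fun u => u.2.2) hxy
    simp only [c, decide_eq_decide] at h1
    exact h1.mp hx

lemma ofReal_bound {Z : Type} [MeasurableSpace Z] (μ ν : Measure Z) [IsFiniteMeasure μ]
    [IsFiniteMeasure ν] (A B : Set Z) (δ : ℝ) (hδ : 0 ≤ δ) :
    μ A ≤ ν B + ENNReal.ofReal δ ↔ μ.real A ≤ ν.real B + δ := by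
  rw [← ENNReal.ofReal_le_ofReal_iff (by positivity), ENNReal.ofReal_add (by positivity) hδ]
  simp [Measure.real]

lemma real_mono_of_null {Z : Type} [MeasurableSpace Z] (μ : Measure Z) [IsFiniteMeasure μ]
    {K A B : Set Z} (hK : μ Kᶜ = 0) (h : A ∩ K ⊆ B) : μ.real A ≤ μ.real B := by
  apply ENNReal.toReal_mono (measure_ne_top _ _)
  calc μ A ≤ μ (B ∪ Kᶜ) := by
        apply measure_mono
        intro x hx
        by_cases hxK : x ∈ K
        · exact Or.inl (h ⟨hx, hxK⟩)
        · exact Or.inr hxK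
    _ ≤ μ B + μ Kᶜ := measure_union_le _ _
    _ = μ B := by rw [hK, add_zero]

lemma cthickening_near {Z : Type} [MetricSpace Z] {A : Set Z} {δ η : ℝ} (hη : 0 < η)
    (hδ : 0 < δ) {y : Z} (hy : y ∈ Metric.cthickening δ A) : ∃ x ∈ A, dist y x < δ + η := by
  have := Metric.cthickening_subset_thickening' (by linarith : 0 < δ + η) (by linarith) A hy
  rwa [Metric.mem_thickening_iff] at this

set_option maxHeartbeats 1000000 in
lemma core {Z : Type} [MetricSpace Z] [MeasurableSpace Z] [BorelSpace Z]
    (μ ν : Measure Z) [IsFiniteMeasure μ] [IsFiniteMeasure ν] (KX KY : Set Z)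
    (hKX : IsCompact KX) (hKY : IsCompact KY) (hμ : μ KXᶜ = 0) (hν : ν KYᶜ = 0)
    (a b : Z) (ha : a ∈ KX) {δ δ' ε s : ℝ} (hδ : 0 < δ) (hδδ' : δ < δ')
    (hε : 2 * δ' ≤ ε) (hsε : 0 ≤ s - ε) (hab : dist a b < δ)
    (hXY : ∀ x ∈ KX, ∃ y ∈ KY, dist x y < δ) (hYX : ∀ y ∈ KY, ∃ x ∈ KX, dist x y < δ)
    (hP : ProkLE μ ν δ) :
    ∃ (M : Set Z) (ν' : Measure Z), IsCompact M ∧ M ⊆ KY ∧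
      KY ∩ Metric.closedBall b (s - ε) ⊆ M ∧ ν' ≤ ν ∧ ν' Mᶜ = 0 ∧
      ν.restrict (KY ∩ Metric.closedBall b (s - ε)) ≤ ν' ∧
      Metric.hausdorffDist (KX ∩ Metric.closedBall a s) M ≤ δ' ∧
      ProkLE (μ.restrict (KX ∩ Metric.closedBall a s)) ν' δ' := by
  classical
  set K := KX ∩ Metric.closedBall a s with hKdef
  set L := KY ∩ Metric.closedBall b (s - ε) with hLdef
  have hKc : IsCompact K := hKX.inter_right Metric.isClosed_closedBall
  have hLc : IsCompact L := hKY.inter_right Metric.isClosed_closedBall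
  have haK : a ∈ K := ⟨ha, Metric.mem_closedBall_self (by linarith)⟩
  -- points of KX close to L lie in K
  have hLK : ∀ x ∈ KX, ∀ y ∈ L, dist x y ≤ δ' → x ∈ K := by
    intro x hx y hy hxy
    refine ⟨hx, ?_⟩
    have h1 := hy.2
    rw [Metric.mem_closedBall] at h1 ⊢
    have h2 := dist_triangle x y a
    have h3 := dist_triangle y b a
    rw [dist_comm b a] at h3
    linarith
  obtain ⟨η, hη0, hη⟩ : ∃ η : ℝ, 0 < η ∧ δ + 3 * η = δ' :=
    ⟨(δ' - δ) / 3, by linarith, by ring⟩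
  obtain ⟨ι, _, _, c, hcm, hcd, hcK, hcL⟩ := exists_label (KX ∪ KY) K L (hKX.union hKY)
    hKc.measurableSet hLc.measurableSet η hη0
  let R : ι → ι → Prop := fun i j => ∃ x ∈ KX, ∃ y ∈ KY, c x = i ∧ c y = j ∧ dist x y ≤ δ + η
  set p : ι → ℝ := fun i => μ.real (c ⁻¹' {i}) with hp
  set q : ι → ℝ := fun i => ν.real (c ⁻¹' {i}) with hq
  have hsum : ∀ (m : Measure Z) [IsFiniteMeasure m] (S : Finset ι),
      ∑ i ∈ S, m.real (c ⁻¹' {i}) = m.real (c ⁻¹' (S : Set ι)) := by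
    intro m _ S
    exact sum_measureReal_preimage_singleton S fun i _ => hcm i
  have hp0 : ∀ i, 0 ≤ p i := fun i => measureReal_nonneg
  have hq0 : ∀ i, 0 ≤ q i := fun i => measureReal_nonneg
  obtain ⟨α, hα0, hαR, hrow, hcol, hdX, hdY⟩ := flow_two p q hp0 hq0 R δ η hη0
    (by
      intro S
      rw [hsum μ, hsum ν]
      have h1 := ((hP (closure (c ⁻¹' (S : Set ι) ∩ KX)) isClosed_closure).1)
      rw [ofReal_bound _ _ _ _ _ hδ.le, Metric.cthickening_closure] at h1
      have h2 : μ.real (c ⁻¹' (S : Set ι)) ≤ μ.real (closure (c ⁻¹' (S : Set ι) ∩ KX)) :=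
        real_mono_of_null μ hμ subset_closure
      refine h2.trans (h1.trans (add_le_add ?_ le_rfl))
      refine real_mono_of_null ν hν ?_
      rintro y ⟨hy, hyK⟩
      obtain ⟨x, ⟨hxS, hxK⟩, hxy⟩ := cthickening_near hη0 hδ hy
      rw [dist_comm] at hxy
      simp only [Set.mem_preimage, Finset.mem_coe, Finset.mem_filter, Finset.mem_univ, true_and]
      exact ⟨c x, hxS, x, hxK, y, hyK, rfl, rfl, hxy.le⟩)
    (by
      intro S
      rw [hsum μ, hsum ν]
      have h1 := ((hP (closure (c ⁻¹' (S : Set ι) ∩ KY)) isClosed_closure).2)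
      rw [ofReal_bound _ _ _ _ _ hδ.le, Metric.cthickening_closure] at h1
      have h2 : ν.real (c ⁻¹' (S : Set ι)) ≤ ν.real (closure (c ⁻¹' (S : Set ι) ∩ KY)) :=
        real_mono_of_null ν hν subset_closure
      refine h2.trans (h1.trans (add_le_add ?_ le_rfl))
      refine real_mono_of_null μ hμ ?_
      rintro x ⟨hx, hxK⟩
      obtain ⟨y, ⟨hyS, hyK⟩, hxy⟩ := cthickening_near hη0 hδ hx
      simp only [Set.mem_preimage, Finset.mem_coe, Finset.mem_filter, Finset.mem_univ, true_and]
      exact ⟨c y, hyS, x, hxK, y, hyK, rfl, rfl, hxy.le⟩)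
  let kf : ι → Prop := fun i => ∃ x ∈ K, c x = i
  let lf : ι → Prop := fun j => ∃ y ∈ L, c y = j
  set β : ι → ℝ := fun j => ∑ i ∈ Finset.univ.filter kf, α i j with hβ
  have hβ0 : ∀ j, 0 ≤ β j := fun j => Finset.sum_nonneg fun i _ => hα0 i j
  have hβle : ∀ j, β j ≤ ∑ i, α i j := fun j =>
    Finset.sum_le_sum_of_subset_of_nonneg (Finset.subset_univ _) fun i _ _ => hα0 i j
  have hβL : ∀ j, lf j → β j = ∑ i, α i j := by
    rintro j ⟨y, hyL, rfl⟩
    apply Finset.sum_subset (Finset.subset_univ _)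
    intro i _ hi
    by_contra hne
    obtain ⟨x, hx, y', hy', hxi, hyy, hd⟩ := hαR i _ hne
    apply hi
    simp only [Finset.mem_filter, Finset.mem_univ, true_and]
    exact ⟨x, hLK x hx y' (hcL _ _ hyy.symm hyL) (by linarith), hxi⟩
  let h : ι → ℝ := fun j => if lf j then 1 else β j / q j
  have hh0 : ∀ j, 0 ≤ h j := by
    intro j
    simp only [h]
    split_ifs
    · exact zero_le_one
    · exact div_nonneg (hβ0 j) (hq0 j)
  have hh1 : ∀ j, h j ≤ 1 := by
    intro j
    simp only [h]
    split_ifs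
    · exact le_rfl
    · exact div_le_one_of_le₀ ((hβle j).trans (hcol j)) (hq0 j)
  have hhq : ∀ j, ¬ lf j → h j * q j = β j := by
    intro j hj
    simp only [h, hj, if_false]
    by_cases h0 : q j = 0
    · have := (hβle j).trans (hcol j)
      rw [h0] at this ⊢
      have := hβ0 j
      simp; linarith
    · field_simp
  have hhq1 : ∀ j, β j ≤ h j * q j := by
    intro j
    by_cases hj : lf j
    · simp only [h, hj, if_true, one_mul]
      exact (hβle j).trans (hcol j)
    · exact (hhq j hj).ge
  have hhq2 : ∀ j, h j * q j ≤ β j + (q j - ∑ i, α i j) := by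
    intro j
    by_cases hj : lf j
    · rw [hβL j hj]
      simp [h, hj]
    · rw [hhq j hj]
      linarith [hcol j]
  let ν' : Measure Z := ∑ j, ENNReal.ofReal (h j) • ν.restrict (c ⁻¹' {j})
  have hν'a : ∀ A, MeasurableSet A →
      ν' A = ∑ j, ENNReal.ofReal (h j) * ν (A ∩ c ⁻¹' {j}) := by
    intro A hA
    simp only [ν', Measure.coe_finsetSum, Finset.sum_apply, Measure.smul_apply, smul_eq_mul]
    exact Finset.sum_congr rfl fun j _ => by rw [Measure.restrict_apply hA]
  have hsplit : ∀ (m : Measure Z) (A : Set Z), MeasurableSet A →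
      m A = ∑ j, m (A ∩ c ⁻¹' {j}) := by
    intro m A hA
    have := sum_measure_preimage_singleton (μ := m.restrict A) (f := c) Finset.univ
      fun i _ => hcm i
    simp only [Finset.coe_univ, Set.preimage_univ, Measure.restrict_apply_univ] at this
    rw [← this]
    exact Finset.sum_congr rfl fun j _ => by
      rw [Measure.restrict_apply (hcm j), Set.inter_comm]
  have hν'le : ν' ≤ ν := by
    rw [Measure.le_iff]
    intro A hA
    rw [hν'a A hA, hsplit ν A hA]
    refine Finset.sum_le_sum fun j _ => ?_
    calc _ ≤ 1 * ν (A ∩ c ⁻¹' {j}) := by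
          gcongr
          rw [ENNReal.ofReal_le_one]; exact hh1 j
      _ = _ := one_mul _
  have : IsFiniteMeasure ν' := isFiniteMeasure_of_le ν hν'le
  have hν'j : ∀ j, ν'.real (c ⁻¹' {j}) = h j * q j := by
    intro j
    rw [Measure.real, hν'a _ (hcm j), Finset.sum_eq_single j]
    · rw [Set.inter_self, ENNReal.toReal_mul, ENNReal.toReal_ofReal (hh0 j)]
      rfl
    · intro k _ hk
      have : c ⁻¹' {j} ∩ c ⁻¹' {k} = ∅ := by
        ext z
        simp only [Set.mem_inter_iff, Set.mem_preimage, Set.mem_singleton_iff,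
          Set.mem_empty_iff_false, iff_false]
        rintro ⟨rfl, h2⟩
        exact hk h2.symm
      rw [this]; simp
    · simp
  have hν'Y : ν' KYᶜ = 0 := le_antisymm ((hν'le _).trans hν.le) (zero_le)
  have hμK : μ.restrict K Kᶜ = 0 := by
    rw [Measure.restrict_apply hKc.measurableSet.compl]; simp
  have hLM : L ⊆ KY ∩ Metric.cthickening δ' K := by
    intro y hy
    refine ⟨hy.1, ?_⟩
    obtain ⟨x, hx, hxy⟩ := hYX y hy.1
    refine Metric.mem_cthickening_of_dist_le y x δ' K
      (hLK x hx y hy (by linarith)) ?_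
    rw [dist_comm]; linarith
  refine ⟨KY ∩ Metric.cthickening δ' K, ν', hKY.inter_right Metric.isClosed_cthickening,
    Set.inter_subset_left, hLM, hν'le, ?_, ?_, ?_, ?_⟩
  · have hMm : MeasurableSet (KY ∩ Metric.cthickening δ' K) :=
      (hKY.inter_right Metric.isClosed_cthickening).measurableSet
    rw [hν'a _ hMm.compl]
    refine Finset.sum_eq_zero fun j _ => ?_
    by_cases h0 : h j = 0
    · simp [h0]
    have hsub : KY ∩ c ⁻¹' {j} ⊆ KY ∩ Metric.cthickening δ' K := by
      rintro y ⟨hy, hyj⟩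
      have hyj : c y = j := hyj
      by_cases hj : lf j
      · obtain ⟨y', hy', hyj'⟩ := hj
        exact hLM (hcL y' y (by rw [hyj, hyj']) hy')
      · have hb : β j ≠ 0 := by
          intro hb; apply h0; simp [h, hj, hb]
        obtain ⟨i, hi, hij⟩ := Finset.exists_ne_zero_of_sum_ne_zero hb
        simp only [Finset.mem_filter, Finset.mem_univ, true_and] at hi
        obtain ⟨x', hx', hxi'⟩ := hi
        obtain ⟨x, hx, y', hy', hxi, hyj', hd⟩ := hαR i j hij
        refine ⟨hy, Metric.mem_cthickening_of_dist_le y x δ' K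
          (hcK x' x (by rw [hxi', hxi]) hx') ?_⟩
        have h1 := hcd y (Or.inr hy) y' (Or.inr hy') (by rw [hyj, hyj'])
        have h2 := dist_triangle y y' x
        rw [dist_comm y' x] at h2
        linarith
    have : ν ((KY ∩ Metric.cthickening δ' K)ᶜ ∩ c ⁻¹' {j}) = 0 := by
      refine measure_mono_null ?_ hν
      rintro y ⟨hy, hyj⟩ hyK
      exact hy (hsub ⟨hyK, hyj⟩)
    rw [this, mul_zero]
  · rw [Measure.le_iff]
    intro A hA
    rw [Measure.restrict_apply hA, hν'a A hA, hsplit ν _ (hA.inter hLc.measurableSet)]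
    refine Finset.sum_le_sum fun j _ => ?_
    by_cases hj : lf j
    · simp only [h, hj, if_true, ENNReal.ofReal_one, one_mul]
      exact measure_mono (Set.inter_subset_inter_left _ Set.inter_subset_left)
    · have : A ∩ L ∩ c ⁻¹' {j} = ∅ := by
        ext z
        simp only [Set.mem_inter_iff, Set.mem_preimage, Set.mem_singleton_iff,
          Set.mem_empty_iff_false, iff_false]
        rintro ⟨⟨_, hz⟩, hzj⟩
        exact hj ⟨z, hz, hzj⟩
      rw [this]; simp
  · refine Metric.hausdorffDist_le_of_mem_dist (by linarith) ?_ ?_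
    · intro x hx
      obtain ⟨y, hy, hxy⟩ := hXY x hx.1
      exact ⟨y, ⟨hy, Metric.mem_cthickening_of_dist_le y x δ' K hx
        (by rw [dist_comm]; linarith)⟩, by linarith⟩
    · rintro y ⟨_, hy⟩
      rw [hKc.cthickening_eq_biUnion_closedBall (by linarith)] at hy
      simp only [Set.mem_iUnion, Metric.mem_closedBall] at hy
      obtain ⟨x, hx, hxy⟩ := hy
      exact ⟨x, hx, hxy⟩
  · intro A hA
    rw [ofReal_bound _ _ _ _ _ (by linarith), ofReal_bound _ _ _ _ _ (by linarith)]
    constructor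
    · set S := Finset.univ.filter (fun i => kf i ∧ ∃ x ∈ KX, x ∈ A ∧ c x = i) with hS
      set T := Finset.univ.filter (fun j => ∃ i ∈ S, R i j) with hT
      have e1 : (μ.restrict K).real A ≤ ∑ i ∈ S, p i := by
        rw [hsum μ]
        refine le_trans (real_mono_of_null _ hμK (B := c ⁻¹' (S : Set ι)) ?_) ?_
        · rintro x ⟨hxA, hxK⟩
          simp only [hS, Set.mem_preimage, Finset.mem_coe, Finset.mem_filter, Finset.mem_univ,
            true_and]
          exact ⟨⟨x, hxK, rfl⟩, x, hxK.1, hxA, rfl⟩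
        · exact ENNReal.toReal_mono (measure_ne_top _ _) (Measure.restrict_le_self _)
      have e2 : ∑ i ∈ S, ∑ j, α i j ≤ ∑ j ∈ T, β j := by
        rw [Finset.sum_comm]
        rw [← Finset.sum_subset (Finset.subset_univ T)]
        · refine Finset.sum_le_sum fun j _ => ?_
          refine Finset.sum_le_sum_of_subset_of_nonneg ?_ fun i _ _ => hα0 i j
          intro i hi
          simp only [hS, Finset.mem_filter, Finset.mem_univ, true_and] at hi ⊢
          exact hi.1
        · intro j _ hj
          refine Finset.sum_eq_zero fun i hi => ?_
          by_contra hne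
          apply hj
          simp only [hT, Finset.mem_filter, Finset.mem_univ, true_and]
          exact ⟨i, hi, hαR i j hne⟩
      have e3 : ∑ j ∈ T, β j ≤ ν'.real (Metric.cthickening δ' A) := by
        calc _ ≤ ∑ j ∈ T, ν'.real (c ⁻¹' {j}) :=
              Finset.sum_le_sum fun j _ => (hhq1 j).trans (hν'j j).ge
          _ = _ := hsum ν' T
          _ ≤ _ := by
            refine real_mono_of_null ν' hν'Y ?_
            rintro y ⟨hyT, hyK⟩
            simp only [hT, hS, Set.mem_preimage, Finset.mem_coe, Finset.mem_filter,
              Finset.mem_univ, true_and] at hyT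
            obtain ⟨i, ⟨-, x', hx'K, hx'A, hx'i⟩, x, hx, y', hy', hxi, hyj, hd⟩ := hyT
            refine Metric.mem_cthickening_of_dist_le y x' δ' A hx'A ?_
            have h1 := hcd y (Or.inr hyK) y' (Or.inr hy') hyj.symm
            have h2 := hcd x (Or.inl hx) x' (Or.inl hx'K) (by rw [hxi, hx'i])
            have h3 := dist_triangle4 y y' x x'
            rw [dist_comm y' x] at h3
            linarith
      have := hdX S
      linarith
    · set S := Finset.univ.filter (fun j => ∃ y ∈ KY, y ∈ A ∧ c y = j) with hS
      set T := Finset.univ.filter (fun i => kf i ∧ ∃ j ∈ S, R i j) with hT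
      have e1 : ν'.real A ≤ ∑ j ∈ S, h j * q j := by
        rw [← Finset.sum_congr rfl fun j _ => hν'j j, hsum ν']
        refine real_mono_of_null ν' hν'Y ?_
        rintro y ⟨hyA, hyK⟩
        simp only [hS, Set.mem_preimage, Finset.mem_coe, Finset.mem_filter, Finset.mem_univ,
            true_and]
        exact ⟨y, hyK, hyA, rfl⟩
      have e2 : ∑ j ∈ S, h j * q j ≤ ∑ j ∈ S, β j + (∑ j ∈ S, q j - ∑ j ∈ S, ∑ i, α i j) := by
        rw [← Finset.sum_sub_distrib, ← Finset.sum_add_distrib]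
        exact Finset.sum_le_sum fun j _ => hhq2 j
      have e3 : ∑ j ∈ S, β j ≤ ∑ i ∈ T, p i := by
        simp only [hβ]
        rw [Finset.sum_comm, ← Finset.sum_subset (s₁ := T)]
        · refine Finset.sum_le_sum fun i _ => le_trans ?_ (hrow i)
          exact Finset.sum_le_sum_of_subset_of_nonneg (Finset.subset_univ _)
            fun j _ _ => hα0 i j
        · intro i hi
          simp only [hT, Finset.mem_filter, Finset.mem_univ, true_and] at hi ⊢
          exact hi.1
        · intro i hi hiT
          refine Finset.sum_eq_zero fun j hj => ?_
          by_contra hne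
          apply hiT
          simp only [hT, Finset.mem_filter, Finset.mem_univ, true_and] at hi ⊢
          exact ⟨hi, j, hj, hαR i j hne⟩
      have e4 : ∑ i ∈ T, p i ≤ (μ.restrict K).real (Metric.cthickening δ' A) := by
        rw [hsum μ]
        have e5 : (μ.restrict K).real (c ⁻¹' (T : Set ι)) = μ.real (c ⁻¹' (T : Set ι)) := by
          rw [Measure.real, Measure.restrict_apply' hKc.measurableSet, Measure.real]
          congr 2
          refine Set.inter_eq_left.mpr ?_
          intro x hx
          simp only [hT, Set.mem_preimage, Finset.mem_coe, Finset.mem_filter, Finset.mem_univ,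
            true_and] at hx
          obtain ⟨⟨x', hx', hxx⟩, -⟩ := hx
          exact hcK x' x hxx hx'
        rw [← e5]
        refine real_mono_of_null _ hμK ?_
        rintro x ⟨hxT, hxK⟩
        simp only [hT, hS, Set.mem_preimage, Finset.mem_coe, Finset.mem_filter,
              Finset.mem_univ, true_and] at hxT
        obtain ⟨-, j, ⟨y', hy'K, hy'A, hy'j⟩, x', hx', y, hy, hxi, hyj, hd⟩ := hxT
        refine Metric.mem_cthickening_of_dist_le x y' δ' A hy'A ?_
        have h1 := hcd x (Or.inl hxK.1) x' (Or.inl hx') hxi.symm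
        have h2 := hcd y (Or.inr hy) y' (Or.inr hy'K) (by rw [hyj, hy'j])
        have h3 := dist_triangle4 x x' y y'
        linarith
      have := hdY S
      linarith

/-- The inclusion of a pmm-subspace. -/
def SubPMM.emb {𝒳 : PMM} (S : SubPMM 𝒳) : S.toPMM.carrier → 𝒳.carrier := Subtype.val

/-- The inclusion between pmm-subspaces. -/
def SubPMM.incl {𝒳 : PMM} {S T : SubPMM 𝒳} (h : S.set ⊆ T.set) :
    S.toPMM.carrier → T.toPMM.carrier := Set.inclusion h

lemma SubPMM.isometry_emb {𝒳 : PMM} (S : SubPMM 𝒳) : Isometry S.emb := isometry_subtype_coe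

lemma SubPMM.isometry_incl {𝒳 : PMM} {S T : SubPMM 𝒳} (h : S.set ⊆ T.set) :
    Isometry (SubPMM.incl h) := fun _ _ => rfl

lemma SubPMM.range_emb {𝒳 : PMM} (S : SubPMM 𝒳) : Set.range S.emb = S.set := Subtype.range_coe

lemma SubPMM.emb_incl {𝒳 : PMM} {S T : SubPMM 𝒳} (h : S.set ⊆ T.set) (x : S.toPMM.carrier) :
    T.emb (SubPMM.incl h x) = S.emb x := rfl

lemma SubPMM.measurableEmbedding_emb {𝒳 : PMM} (S : SubPMM 𝒳) (hS : MeasurableSet S.set) :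
    MeasurableEmbedding S.emb :=
  S.isometry_emb.isEmbedding.measurableEmbedding (by rwa [S.range_emb])

lemma restrict_of_null {α : Type*} [MeasurableSpace α] (μ : Measure α) (s : Set α)
    (h : μ sᶜ = 0) : μ.restrict s = μ :=
  Measure.restrict_eq_self_of_ae_mem (by rwa [ae_iff])

lemma SubPMM.map_emb {𝒳 : PMM} (S : SubPMM 𝒳) (hS : MeasurableSet S.set) :
    S.toPMM.meas.map S.emb = S.meas := by
  have : S.toPMM.meas = S.meas.comap S.emb := rfl
  rw [this, (S.measurableEmbedding_emb hS).map_comap, S.range_emb]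
  exact restrict_of_null _ _ S.supported

lemma map_inj {α β : Type*} [MeasurableSpace α] [MeasurableSpace β] {f : α → β}
    (hf : MeasurableEmbedding f) {μ ν : Measure α} (h : μ.map f = ν.map f) : μ = ν := by
  rw [← hf.comap_map μ, h, hf.comap_map]

lemma comap_mono_emb {α β : Type*} [MeasurableSpace α] [MeasurableSpace β] {f : α → β}
    (hf : MeasurableEmbedding f) {μ ν : Measure β} (h : μ ≤ ν) : μ.comap f ≤ ν.comap f := by
  rw [Measure.le_iff]
  intro s _
  rw [hf.comap_apply, hf.comap_apply]
  exact h _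

lemma ballSub_set (𝒳 : PMM) {r : ℝ} (hr : 0 ≤ r) :
    (𝒳.ballSub r).set = Metric.closedBall 𝒳.basepoint r :=
  Set.insert_eq_of_mem (Metric.mem_closedBall_self hr)

lemma ballSub_meas (𝒳 : PMM) (r : ℝ) :
    (𝒳.ballSub r).meas = 𝒳.meas.restrict (𝒳.ballSub r).set := rfl

lemma ballSub_measurable (𝒳 : PMM) (r : ℝ) : MeasurableSet (𝒳.ballSub r).set :=
  measurableSet_closedBall.insert 𝒳.basepoint

lemma ballSub_compact (𝒳 : PMM) (h : 𝒳.BoundedlyCompact) {r : ℝ} (hr : 0 ≤ r) :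
    CompactSpace (𝒳.ballSub r).toPMM.carrier := by
  have : IsCompact (𝒳.ballSub r).set := by
    rw [ballSub_set 𝒳 hr]; exact h.1 _ _
  exact isCompact_iff_compactSpace.mp this

lemma ballSub_finite (𝒳 : PMM) (h : 𝒳.BoundedlyCompact) {r : ℝ} (hr : 0 ≤ r) :
    IsFiniteMeasure (𝒳.ballSub r).toPMM.meas := by
  constructor
  have h1 := (𝒳.ballSub r).map_emb (ballSub_measurable 𝒳 r)
  have h2 := congrArg (fun m => m Set.univ) h1
  simp only [((𝒳.ballSub r).measurableEmbedding_emb (ballSub_measurable 𝒳 r)).map_apply,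
    Set.preimage_univ] at h2
  rw [h2, ballSub_meas, Measure.restrict_apply_univ, ballSub_set 𝒳 hr]
  exact (h.2 _ _).lt_top

lemma prokhorovDist_nonneg {Z : Type} [MetricSpace Z] [MeasurableSpace Z] (μ ν : Measure Z) :
    0 ≤ prokhorovDist μ ν := Real.sInf_nonneg fun _ hx => hx.1.le

lemma prokhorovDist_le {Z : Type} [MetricSpace Z] [MeasurableSpace Z] {μ ν : Measure Z}
    {δ : ℝ} (hδ : 0 < δ) (h : ProkLE μ ν δ) : prokhorovDist μ ν ≤ δ :=
  csInf_le ⟨0, fun _ hx => hx.1.le⟩ ⟨hδ, h⟩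

lemma prokLE_of_lt {Z : Type} [MetricSpace Z] [MeasurableSpace Z] {μ ν : Measure Z}
    [IsFiniteMeasure μ] [IsFiniteMeasure ν]
    {δ : ℝ} (h : prokhorovDist μ ν < δ) : ProkLE μ ν δ := by
  have hne : {ε : ℝ | 0 < ε ∧ ∀ A : Set Z, IsClosed A →
    μ A ≤ ν (Metric.cthickening ε A) + ENNReal.ofReal ε ∧
    ν A ≤ μ (Metric.cthickening ε A) + ENNReal.ofReal ε}.Nonempty := by
    refine ⟨μ.real Set.univ + ν.real Set.univ + 1, by positivity, fun A _ => ⟨?_, ?_⟩⟩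
    · refine le_trans ?_ le_add_self
      calc μ A ≤ μ Set.univ := measure_mono (Set.subset_univ _)
        _ = ENNReal.ofReal (μ.real Set.univ) := by simp [Measure.real]
        _ ≤ _ := ENNReal.ofReal_le_ofReal (by
          have : 0 ≤ ν.real Set.univ := measureReal_nonneg
          linarith)
    · refine le_trans ?_ le_add_self
      calc ν A ≤ ν Set.univ := measure_mono (Set.subset_univ _)
        _ = ENNReal.ofReal (ν.real Set.univ) := by simp [Measure.real]
        _ ≤ _ := ENNReal.ofReal_le_ofReal (by
          have : 0 ≤ μ.real Set.univ := measureReal_nonneg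
          linarith)
  obtain ⟨ε, ⟨_, hε⟩, hlt⟩ := exists_lt_of_csInf_lt hne h
  intro A hA
  have hm : Metric.cthickening ε A ⊆ Metric.cthickening δ A :=
    Metric.cthickening_mono hlt.le A
  have ho : ENNReal.ofReal ε ≤ ENNReal.ofReal δ := ENNReal.ofReal_le_ofReal hlt.le
  exact ⟨(hε A hA).1.trans (add_le_add (measure_mono hm) ho),
    (hε A hA).2.trans (add_le_add (measure_mono hm) ho)⟩

lemma value_nonneg {𝒳 𝒴 : PMM} (e : GHPEmbedding 𝒳 𝒴) : 0 ≤ e.value :=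
  le_trans dist_nonneg (le_max_left _ _)

lemma cGHP_bdd (𝒳 𝒴 : PMM) :
    BddBelow {x : ℝ | ∃ e : GHPEmbedding 𝒳 𝒴, e.IsIsometric ∧ x = e.value} :=
  ⟨0, by rintro _ ⟨e, -, rfl⟩; exact value_nonneg e⟩

lemma cGHP_nonempty (𝒳 𝒴 : PMM) :
    {x : ℝ | ∃ e : GHPEmbedding 𝒳 𝒴, e.IsIsometric ∧ x = e.value}.Nonempty := by
  refine ⟨_, ⟨𝒳.carrier × 𝒴.carrier, inferInstance, fun x => (x, 𝒴.basepoint),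
    fun y => (𝒳.basepoint, y)⟩, ⟨?_, ?_⟩, rfl⟩
  · exact Isometry.of_dist_eq fun x y => by simp [Prod.dist_eq]
  · exact Isometry.of_dist_eq fun x y => by simp [Prod.dist_eq]

lemma cGHP_nonneg (𝒳 𝒴 : PMM) : 0 ≤ cGHP 𝒳 𝒴 :=
  Real.sInf_nonneg (by rintro _ ⟨e, -, rfl⟩; exact value_nonneg e)

lemma cGHP_le_of_emb {𝒳 𝒴 : PMM} (e : GHPEmbedding 𝒳 𝒴) (he : e.IsIsometric) :
    cGHP 𝒳 𝒴 ≤ e.value := csInf_le (cGHP_bdd 𝒳 𝒴) ⟨e, he, rfl⟩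

lemma prokhorovDist_comm {Z : Type} [MetricSpace Z] [MeasurableSpace Z] (μ ν : Measure Z) :
    prokhorovDist μ ν = prokhorovDist ν μ := by
  unfold prokhorovDist
  congr 1
  ext ε
  simp only [Set.mem_ofPred_eq]
  constructor
  · exact fun h => ⟨h.1, fun A hA => (h.2 A hA).symm⟩
  · exact fun h => ⟨h.1, fun A hA => (h.2 A hA).symm⟩

lemma cGHP_le_comm (𝒳 𝒴 : PMM) : cGHP 𝒳 𝒴 ≤ cGHP 𝒴 𝒳 := by
  refine le_csInf (cGHP_nonempty 𝒴 𝒳) ?_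
  rintro _ ⟨e, he, rfl⟩
  refine (cGHP_le_of_emb ⟨e.Z, e.mZ, e.g, e.f⟩ ⟨he.2, he.1⟩).trans (le_of_eq ?_)
  unfold GHPEmbedding.value
  let : MeasurableSpace e.Z := borel e.Z
  simp only
  rw [dist_comm, Metric.hausdorffDist_comm, prokhorovDist_comm]

lemma cGHP_comm (𝒳 𝒴 : PMM) : cGHP 𝒳 𝒴 = cGHP 𝒴 𝒳 :=
  le_antisymm (cGHP_le_comm _ _) (cGHP_le_comm _ _)

lemma map_incl_ball (𝒳 : PMM) {s r : ℝ} (h : (𝒳.ballSub s).set ⊆ (𝒳.ballSub r).set) :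
    (𝒳.ballSub s).toPMM.meas.map (SubPMM.incl h) =
      (𝒳.ballSub r).toPMM.meas.restrict ((𝒳.ballSub r).emb ⁻¹' (𝒳.ballSub s).set) := by
  have her := (𝒳.ballSub r).measurableEmbedding_emb (ballSub_measurable 𝒳 r)
  apply map_inj her
  rw [Measure.map_map her.measurable (SubPMM.isometry_incl h).continuous.measurable,
    ← Measure.restrict_map her.measurable (ballSub_measurable 𝒳 s),
    (𝒳.ballSub r).map_emb (ballSub_measurable 𝒳 r)]
  have : (𝒳.ballSub r).emb ∘ SubPMM.incl h = (𝒳.ballSub s).emb := rfl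
  rw [this, (𝒳.ballSub s).map_emb (ballSub_measurable 𝒳 s), ballSub_meas, ballSub_meas,
    Measure.restrict_restrict (ballSub_measurable 𝒳 s), Set.inter_eq_left.mpr h]

lemma one_side (𝒳 𝒴 : PMM) (hX : 𝒳.BoundedlyCompact) (hY : 𝒴.BoundedlyCompact)
    {r s ε δ δ' : ℝ} (hsr : s ≤ r) (hsε : 0 ≤ s - ε) (hδδ' : δ < δ')
    (hε : 2 * δ' ≤ ε)
    (hd : cGHP (𝒳.ballSub r).toPMM (𝒴.ballSub r).toPMM < δ) :
    ∃ Y' : SubPMM 𝒴, Y'.IsCompactSub ∧ 𝒴.ballSub (s - ε) ≤ Y' ∧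
      cGHP (𝒳.ballSub s).toPMM Y'.toPMM ≤ δ' := by
  have hδ : 0 < δ := (cGHP_nonneg _ _).trans_lt hd
  have hs : 0 ≤ s := by linarith
  have hr : 0 ≤ r := by linarith
  set A := 𝒳.ballSub r with hA
  set B := 𝒴.ballSub r with hB
  obtain ⟨_, ⟨e, ⟨hf, hg⟩, rfl⟩, hlt⟩ := exists_lt_of_csInf_lt (cGHP_nonempty _ _) hd
  obtain ⟨Z, mZ, f, g⟩ := e
  let : MeasurableSpace Z := borel Z
  have : BorelSpace Z := ⟨rfl⟩
  have hCX := ballSub_compact 𝒳 hX hr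
  have hCY := ballSub_compact 𝒴 hY hr
  have hFX := ballSub_finite 𝒳 hX hr
  have hFY := ballSub_finite 𝒴 hY hr
  change Isometry f at hf
  change Isometry g at hg
  have hlt' : max (dist (f A.toPMM.basepoint) (g B.toPMM.basepoint))
    (max (Metric.hausdorffDist (Set.range f) (Set.range g))
      (prokhorovDist (A.toPMM.meas.map f) (B.toPMM.meas.map g))) < δ := hlt
  rw [max_lt_iff, max_lt_iff] at hlt'
  obtain ⟨hdist, hH, hP⟩ := hlt'
  have hKX : IsCompact (Set.range f) := isCompact_range hf.continuous
  have hKY : IsCompact (Set.range g) := isCompact_range hg.continuous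
  have hfe : MeasurableEmbedding f := hf.isEmbedding.measurableEmbedding hKX.measurableSet
  have hge : MeasurableEmbedding g := hg.isEmbedding.measurableEmbedding hKY.measurableSet
  have hAe : MeasurableEmbedding A.emb := A.measurableEmbedding_emb (ballSub_measurable 𝒳 r)
  have hBe : MeasurableEmbedding B.emb := B.measurableEmbedding_emb (ballSub_measurable 𝒴 r)
  have hfin : Metric.hausdorffEDist (Set.range f) (Set.range g) ≠ ⊤ :=
    Metric.hausdorffEDist_ne_top_of_nonempty_of_bounded ⟨_, A.toPMM.basepoint, rfl⟩
      ⟨_, B.toPMM.basepoint, rfl⟩ hKX.isBounded hKY.isBounded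
  have hnull : ∀ {W : Type} [MeasurableSpace W] (m : Measure W) (u : W → Z)
      (_ : MeasurableEmbedding u), m.map u (Set.range u)ᶜ = 0 := by
    intro W _ m u hu
    rw [hu.map_apply]
    have : u ⁻¹' (Set.range u)ᶜ = ∅ := by ext; simp
    rw [this]; simp
  obtain ⟨M, ν', hMc, hMs, hLM, hν'le, hν'M, hν'L, hHM, hPM⟩ := core (A.toPMM.meas.map f)
    (B.toPMM.meas.map g) (Set.range f) (Set.range g) hKX hKY (hnull _ _ hfe) (hnull _ _ hge)
    (f A.toPMM.basepoint) (g B.toPMM.basepoint) ⟨_, rfl⟩ hδ hδδ' hε hsε hdist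
    (fun x hx => Metric.exists_dist_lt_of_hausdorffDist_lt hx hH hfin)
    (fun y hy => Metric.exists_dist_lt_of_hausdorffDist_lt' hy hH hfin) (prokLE_of_lt hP)
  have hbL : g B.toPMM.basepoint ∈ M := hLM ⟨⟨_, rfl⟩, Metric.mem_closedBall_self hsε⟩
  -- preimages of balls
  have hBpre : g ⁻¹' (Set.range g ∩ Metric.closedBall (g B.toPMM.basepoint) (s - ε)) =
      B.emb ⁻¹' (𝒴.ballSub (s - ε)).set := by
    rw [ballSub_set 𝒴 hsε]
    ext y
    simp only [Set.mem_preimage, Set.mem_inter_iff, Set.mem_range_self, true_and,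
      Metric.mem_closedBall, hg.dist_eq]
    rfl
  have hApre : f ⁻¹' (Set.range f ∩ Metric.closedBall (f A.toPMM.basepoint) s) =
      A.emb ⁻¹' (𝒳.ballSub s).set := by
    rw [ballSub_set 𝒳 hs]
    ext y
    simp only [Set.mem_preimage, Set.mem_inter_iff, Set.mem_range_self, true_and,
      Metric.mem_closedBall, hf.dist_eq]
    rfl
  have hXsub : (𝒳.ballSub s).set ⊆ A.set := by
    rw [hA, ballSub_set 𝒳 hs, ballSub_set 𝒳 hr]
    exact Metric.closedBall_subset_closedBall hsr
  have hYsub : (𝒴.ballSub (s - ε)).set ⊆ B.set := by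
    rw [hB, ballSub_set 𝒴 hsε, ballSub_set 𝒴 hr]
    exact Metric.closedBall_subset_closedBall (by linarith)
  have hMmeas : MeasurableSet M := hMc.measurableSet
  have hBmap : B.toPMM.meas.map B.emb = 𝒴.meas.restrict B.set :=
    B.map_emb (ballSub_measurable 𝒴 r)
  have hle1 : (ν'.comap g).map B.emb ≤ 𝒴.meas.restrict B.set := by
    rw [← hBmap]
    refine Measure.map_mono ?_ hBe.measurable
    calc ν'.comap g ≤ (B.toPMM.meas.map g).comap g := comap_mono_emb hge hν'le
      _ = _ := hge.comap_map _
  let Y' : SubPMM 𝒴 :=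
    { set := B.emb '' (g ⁻¹' M)
      root_mem := ⟨B.toPMM.basepoint, hbL, rfl⟩
      meas := (ν'.comap g).map B.emb
      meas_le := hle1.trans Measure.restrict_le_self
      supported := by
        rw [hBe.map_apply, hge.comap_apply]
        refine measure_mono_null ?_ hν'M
        rintro _ ⟨y, hy, rfl⟩ hyM
        exact hy ⟨y, hyM, rfl⟩ }
  have hY'c : IsCompact Y'.set :=
    ((hMc.isClosed.preimage hg.continuous).isCompact).image B.isometry_emb.continuous
  have hY'B : Y'.set ⊆ B.set := by
    rintro _ ⟨y, -, rfl⟩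
    exact y.2
  refine ⟨Y', ⟨hY'c, ?_⟩, ⟨?_, ?_⟩, ?_⟩
  · have h1 := hle1 Set.univ
    rw [Measure.restrict_apply_univ] at h1
    have h2 : 𝒴.meas B.set ≠ ⊤ := by
      rw [hB, ballSub_set 𝒴 hr]; exact hY.2 _ _
    exact ne_top_of_le_ne_top h2 h1
  · intro y hy
    obtain ⟨w, rfl⟩ : ∃ w, B.emb w = y := by
      rw [← Set.mem_range, B.range_emb]; exact hYsub hy
    refine ⟨w, ?_, rfl⟩
    apply hLM
    rw [← Set.mem_preimage, hBpre]
    exact hy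
  · change 𝒴.meas.restrict (𝒴.ballSub (s - ε)).set ≤ (ν'.comap g).map B.emb
    have h1 : 𝒴.meas.restrict (𝒴.ballSub (s - ε)).set =
        (B.toPMM.meas.map B.emb).restrict (𝒴.ballSub (s - ε)).set := by
      rw [hBmap, Measure.restrict_restrict (ballSub_measurable 𝒴 _),
        Set.inter_eq_left.mpr hYsub]
    rw [h1, Measure.restrict_map hBe.measurable (ballSub_measurable 𝒴 _), ← hBpre]
    refine Measure.map_mono ?_ hBe.measurable
    rw [← hge.comap_map (B.toPMM.meas.restrict _), ← Measure.restrict_map hge.measurable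
      (hKY.inter_right Metric.isClosed_closedBall).measurableSet]
    exact comap_mono_emb hge hν'L
  · have hY'e := Y'.measurableEmbedding_emb hY'c.measurableSet
    refine (cGHP_le_of_emb ⟨Z, mZ, f ∘ SubPMM.incl hXsub, g ∘ SubPMM.incl hY'B⟩
      ⟨hf.comp (SubPMM.isometry_incl _), hg.comp (SubPMM.isometry_incl _)⟩).trans ?_
    change max (dist (f A.toPMM.basepoint) (g B.toPMM.basepoint))
      (max (Metric.hausdorffDist (Set.range (f ∘ SubPMM.incl hXsub))
          (Set.range (g ∘ SubPMM.incl hY'B)))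
        (prokhorovDist ((𝒳.ballSub s).toPMM.meas.map (f ∘ SubPMM.incl hXsub))
          (Y'.toPMM.meas.map (g ∘ SubPMM.incl hY'B)))) ≤ δ'
    have e1 : Set.range (f ∘ SubPMM.incl hXsub) =
        Set.range f ∩ Metric.closedBall (f A.toPMM.basepoint) s := by
      ext z
      constructor
      · rintro ⟨x, rfl⟩
        rw [Function.comp, ← Set.mem_preimage, hApre]
        exact x.2
      · intro hz
        obtain ⟨x, rfl⟩ := hz.1
        rw [← Set.mem_preimage, hApre] at hz
        exact ⟨⟨x.1, hz⟩, rfl⟩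
    have e2 : Set.range (g ∘ SubPMM.incl hY'B) = M := by
      ext z
      constructor
      · rintro ⟨⟨_, y, hy, rfl⟩, rfl⟩
        exact hy
      · intro hz
        obtain ⟨y, rfl⟩ := hMs hz
        exact ⟨⟨y.1, ⟨y, hz, rfl⟩⟩, rfl⟩
    have e3 : (𝒳.ballSub s).toPMM.meas.map (f ∘ SubPMM.incl hXsub) =
        (A.toPMM.meas.map f).restrict
          (Set.range f ∩ Metric.closedBall (f A.toPMM.basepoint) s) := by
      rw [← Measure.map_map hfe.measurable (SubPMM.isometry_incl hXsub).continuous.measurable,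
        map_incl_ball 𝒳 hXsub, ← hApre, Measure.restrict_map hfe.measurable
        (hKX.inter_right Metric.isClosed_closedBall).measurableSet]
    have e4 : Y'.toPMM.meas.map (g ∘ SubPMM.incl hY'B) = ν' := by
      have h1 : Y'.toPMM.meas.map (SubPMM.incl hY'B) = ν'.comap g := by
        apply map_inj hBe
        rw [Measure.map_map hBe.measurable (SubPMM.isometry_incl hY'B).continuous.measurable]
        exact Y'.map_emb hY'c.measurableSet
      rw [← Measure.map_map hge.measurable (SubPMM.isometry_incl hY'B).continuous.measurable,
        h1, hge.map_comap]
      exact restrict_of_null _ _ (measure_mono_null (Set.compl_subset_compl.mpr hMs) hν'M)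
    rw [e1, e2, e3, e4]
    exact max_le (by linarith) (max_le hHM (prokhorovDist_le (by linarith) hPM))

lemma aFun_lt (𝒳 𝒴 : PMM) (hX : 𝒳.BoundedlyCompact) (hY : 𝒴.BoundedlyCompact)
    {r ε : ℝ} (hr : 1 / r < ε) (hr0 : 0 < r) (hε1 : ε ≤ 1)
    (hd : 2 * cGHP (𝒳.ballSub r).toPMM (𝒴.ballSub r).toPMM < ε) :
    aEps ε 𝒳 𝒴 < ε / 2 := by
  have hε0 : 0 < ε := lt_trans (by positivity) hr
  obtain ⟨δ, hδ1, hδ2⟩ := exists_between (show cGHP (𝒳.ballSub r).toPMM (𝒴.ballSub r).toPMM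
    < ε / 2 by linarith)
  obtain ⟨δ', hδ1', hδ2'⟩ := exists_between hδ2
  have h1 : 1 ≤ 1 / ε := by rw [le_div_iff₀ hε0]; linarith
  have h2 : 1 / ε ≤ r := by
    rw [div_le_iff₀ hε0]; rw [div_lt_iff₀ hr0] at hr; linarith
  obtain ⟨Y', hc, hle, hcG⟩ := one_side 𝒳 𝒴 hX hY h2 (by linarith : 0 ≤ 1 / ε - ε) hδ1'
    (by linarith) hδ1
  refine lt_of_le_of_lt (csInf_le ⟨0, ?_⟩ ⟨Y', hc, hle, rfl⟩) (lt_of_le_of_lt hcG hδ2')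
  rintro _ ⟨_, _, _, rfl⟩
  exact cGHP_nonneg _ _

lemma GHP_bdd (𝒳 𝒴 : PMM) : BddBelow (insert 1 {ε : ℝ | ε ∈ Set.Ioc (0 : ℝ) 1 ∧
    max (aEps ε 𝒳 𝒴) (aEps ε 𝒴 𝒳) < ε / 2}) := by
  refine ⟨0, ?_⟩
  rintro x (rfl | hx)
  · exact zero_le_one
  · exact hx.1.1.le

lemma GHP_nonneg (𝒳 𝒴 : PMM) : 0 ≤ GHP 𝒳 𝒴 := by
  refine Real.sInf_nonneg ?_
  rintro x (rfl | hx)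
  · exact zero_le_one
  · exact hx.1.1.le

lemma GHP_part_one (𝒳 𝒴 : PMM) (hX : 𝒳.BoundedlyCompact) (hY : 𝒴.BoundedlyCompact)
    (r : ℝ) (hr : 0 < r) :
    GHP 𝒳 𝒴 ≤ max (1 / r) (2 * cGHP ((𝒳.ballSub r).toPMM) ((𝒴.ballSub r).toPMM)) := by
  refine le_of_forall_gt_imp_ge_of_dense fun ε hε => ?_
  rcases le_or_gt 1 ε with h1 | h1
  · exact (csInf_le (GHP_bdd 𝒳 𝒴) (Set.mem_insert _ _)).trans h1
  rw [max_lt_iff] at hε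
  refine csInf_le (GHP_bdd 𝒳 𝒴) (Set.mem_insert_of_mem _ ⟨⟨?_, h1.le⟩, max_lt ?_ ?_⟩)
  · exact lt_trans (by positivity) hε.1
  · exact aFun_lt 𝒳 𝒴 hX hY hε.1 hr h1.le hε.2
  · refine aFun_lt 𝒴 𝒳 hY hX hε.1 hr h1.le ?_
    rw [cGHP_comm]; exact hε.2

lemma compact_bounded {𝒳 : PMM} (h : 𝒳.IsCompactPMM) : 𝒳.BoundedlyCompact := by
  have := h.1
  exact ⟨fun x r => Metric.isClosed_closedBall.isCompact,
    fun x r => ne_top_of_le_ne_top h.2 (measure_mono (Set.subset_univ _))⟩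

lemma compact_radius {𝒳 : PMM} (h : 𝒳.IsCompactPMM) :
    ∃ r0 : ℝ, ∀ r, r0 ≤ r → (𝒳.ballSub r).set = Set.univ := by
  have := h.1
  obtain ⟨r0, hr0⟩ := (isCompact_univ (X := 𝒳.carrier)).isBounded.subset_closedBall 𝒳.basepoint
  refine ⟨r0, fun r hr => Set.eq_univ_of_univ_subset ?_⟩
  exact (hr0.trans (Metric.closedBall_subset_closedBall hr)).trans (Set.subset_insert _ _)

lemma cGHP_ball_le (𝒳 𝒴 : PMM) (r : ℝ) (hX : (𝒳.ballSub r).set = Set.univ)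
    (hY : (𝒴.ballSub r).set = Set.univ) :
    cGHP ((𝒳.ballSub r).toPMM) ((𝒴.ballSub r).toPMM) ≤ cGHP 𝒳 𝒴 := by
  refine le_csInf (cGHP_nonempty 𝒳 𝒴) ?_
  rintro _ ⟨e, he, rfl⟩
  obtain ⟨Z, mZ, f, g⟩ := e
  have hf : Isometry f := he.1
  have hg : Isometry g := he.2
  let : MeasurableSpace Z := borel Z
  have : BorelSpace Z := ⟨rfl⟩
  refine (cGHP_le_of_emb ⟨Z, mZ, f ∘ (𝒳.ballSub r).emb, g ∘ (𝒴.ballSub r).emb⟩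
    ⟨hf.comp (SubPMM.isometry_emb _), hg.comp (SubPMM.isometry_emb _)⟩).trans (le_of_eq ?_)
  change max (dist (f 𝒳.basepoint) (g 𝒴.basepoint))
      (max (Metric.hausdorffDist (Set.range (f ∘ (𝒳.ballSub r).emb))
          (Set.range (g ∘ (𝒴.ballSub r).emb)))
        (prokhorovDist ((𝒳.ballSub r).toPMM.meas.map (f ∘ (𝒳.ballSub r).emb))
          ((𝒴.ballSub r).toPMM.meas.map (g ∘ (𝒴.ballSub r).emb)))) =
    max (dist (f 𝒳.basepoint) (g 𝒴.basepoint))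
      (max (Metric.hausdorffDist (Set.range f) (Set.range g))
        (prokhorovDist (𝒳.meas.map f) (𝒴.meas.map g)))
  have key : ∀ (𝒲 : PMM) (u : 𝒲.carrier → Z), Isometry u → (𝒲.ballSub r).set = Set.univ →
      Set.range (u ∘ (𝒲.ballSub r).emb) = Set.range u ∧
      (𝒲.ballSub r).toPMM.meas.map (u ∘ (𝒲.ballSub r).emb) = 𝒲.meas.map u := by
    intro 𝒲 u hu hW
    constructor
    · rw [Set.range_comp, SubPMM.range_emb, hW, Set.image_univ]
    · rw [← Measure.map_map hu.continuous.measurable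
        (SubPMM.isometry_emb _).continuous.measurable,
        SubPMM.map_emb _ (ballSub_measurable 𝒲 r), ballSub_meas, hW, Measure.restrict_univ]
  rw [(key 𝒳 f hf hX).1, (key 𝒳 f hf hX).2, (key 𝒴 g hg hY).1, (key 𝒴 g hg hY).2]

lemma GHP_part_two (𝒳 𝒴 : PMM) (hX : 𝒳.IsCompactPMM) (hY : 𝒴.IsCompactPMM) :
    GHP 𝒳 𝒴 ≤ 2 * cGHP 𝒳 𝒴 := by
  obtain ⟨r1, h1⟩ := compact_radius hX
  obtain ⟨r2, h2⟩ := compact_radius hY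
  have h0 : 0 ≤ 2 * cGHP 𝒳 𝒴 := mul_nonneg zero_le_two (cGHP_nonneg _ _)
  refine le_of_forall_pos_le_add fun t ht => ?_
  set r := max (max r1 r2) (1 / t) with hr
  have hrt : 1 / t ≤ r := le_max_right _ _
  have hr0 : 0 < r := lt_of_lt_of_le (by positivity) hrt
  have h3 := cGHP_ball_le 𝒳 𝒴 r (h1 r ((le_max_left _ _).trans (le_max_left _ _)))
    (h2 r ((le_max_right _ _).trans (le_max_left _ _)))
  have h4 : 1 / r ≤ t := by
    rw [div_le_iff₀ hr0]; rw [div_le_iff₀ ht] at hrt; linarith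
  refine (GHP_part_one 𝒳 𝒴 (compact_bounded hX) (compact_bounded hY) r hr0).trans ?_
  exact max_le (by linarith) (by linarith)

/-- For boundedly compact pmm spaces `𝒳`, `𝒴`:
(i) for every `r > 0`, `d(𝒳,𝒴) ≤ (1/r) ∨ 2 dc(B̄_r(𝒳), B̄_r(𝒴))`;
(ii) if `𝒳`, `𝒴` are compact then `d(𝒳,𝒴) ≤ 2 dc(𝒳,𝒴)`; consequently, on compact pmm
spaces, convergence in `dc` implies convergence in `d` (the topology of `d` is coarser). -/
theorem GHP_le_cGHP :
    (∀ 𝒳 𝒴 : PMM, 𝒳.BoundedlyCompact → 𝒴.BoundedlyCompact → ∀ r : ℝ, 0 < r →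
      GHP 𝒳 𝒴 ≤ max (1 / r) (2 * cGHP ((𝒳.ballSub r).toPMM) ((𝒴.ballSub r).toPMM))) ∧
    (∀ 𝒳 𝒴 : PMM, 𝒳.IsCompactPMM → 𝒴.IsCompactPMM → GHP 𝒳 𝒴 ≤ 2 * cGHP 𝒳 𝒴) ∧
    (∀ (𝒳 : ℕ → PMM) (𝒴 : PMM), (∀ n, (𝒳 n).IsCompactPMM) → 𝒴.IsCompactPMM →
      Tendsto (fun n => cGHP (𝒳 n) 𝒴) atTop (𝓝 0) →
      Tendsto (fun n => GHP (𝒳 n) 𝒴) atTop (𝓝 0)) := by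
  refine ⟨GHP_part_one, GHP_part_two, ?_⟩
  intro 𝒳 𝒴 hX hY h
  refine squeeze_zero (fun n => GHP_nonneg _ _) (fun n => GHP_part_two _ _ (hX n) hY) ?_
  simpa using h.const_mul 2

end
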